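/- arXiv:1304.5659 — 3 statements merged into one kernel-verified Lean document; each statement's English description precedes it below -/
import Mathlib

section
/- Let ε : ℕ → ℝ satisfy ε i ∈ {-1, 1} for every i ≥ 1. Then for every n ≥ 1: (a) r_n = r_n(0) = 2·sin((1 + Σ_{i=1}^n (ε₁ε₂⋯ε_i)/2^i)·π/4), and (b) r_n(2) = 2·sin((1 + Σ_{i=1}^n (ε₁ε₂⋯ε_i)/2^i + (ε₁ε₂⋯ε_n)/2^n)·π/4). -/
open Filter Real

/-- The nested radical `r_n(c) = √(2 + ε₁√(2 + ε₂√(2 + ⋯ + ε_n√(2 + c))))`,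
defined by the recursion `r₀(c) = √(2 + c)`, `r_n(c) = r_{n-1}(ε_n √(2 + c))`. -/
noncomputable def nest (ε : ℕ → ℝ) : ℕ → ℝ → ℝ
  | 0, c => Real.sqrt (2 + c)
  | n + 1, c => nest ε n (ε (n + 1) * Real.sqrt (2 + c))

theorem sqrt_two_add_two_mul_sin {x : ℝ} (hx : |x| ≤ 1) :
    √(2 + 2 * sin (x * (π / 2))) = 2 * sin ((1 + x) * (π / 4)) := by
  obtain ⟨h₁, h₂⟩ := abs_le.mp hx
  have hsin : 0 ≤ sin ((1 + x) * (π / 4)) :=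
    sin_nonneg_of_nonneg_of_le_pi (mul_nonneg (by linarith) (by positivity))
      (by nlinarith [pi_pos])
  have hcos : sin (x * (π / 2)) = -cos (2 * ((1 + x) * (π / 4))) := by
    rw [← sin_sub_pi_div_two]
    ring_nf
  rw [hcos, cos_two_mul, sqrt_eq_iff_mul_self_eq]
  · nlinarith [sin_sq_add_cos_sq ((1 + x) * (π / 4))]
  · nlinarith [sin_sq_add_cos_sq ((1 + x) * (π / 4)), sq_nonneg (sin ((1 + x) * (π / 4)))]
  · positivity

/-- Closed form of `nest ε n c` for `c = 2 sin (x π / 2)`. -/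
theorem nest_two_mul_sin (ε : ℕ → ℝ) (hε : ∀ i, 1 ≤ i → ε i = 1 ∨ ε i = -1)
    (n : ℕ) {x : ℝ} (hx : |x| ≤ 1) :
    nest ε n (2 * sin (x * (π / 2))) = 2 * sin
      ((1 + ∑ i ∈ Finset.Icc 1 n, (∏ j ∈ Finset.Icc 1 i, ε j) / 2 ^ i
        + (∏ j ∈ Finset.Icc 1 n, ε j) / 2 ^ n * x) * (π / 4)) := by
  induction n generalizing x with
  | zero => simpa [nest] using sqrt_two_add_two_mul_sin hx
  | succ n ih =>
    have hε' := hε (n + 1) (by omega)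
    have hstep : ε (n + 1) * √(2 + 2 * sin (x * (π / 2))) =
        2 * sin (ε (n + 1) * ((1 + x) / 2) * (π / 2)) := by
      rw [sqrt_two_add_two_mul_sin hx]
      rcases hε' with h | h <;> rw [h]
      · ring_nf
      · rw [neg_one_mul, neg_one_mul, neg_mul, sin_neg]
        ring_nf
    have hbound : |ε (n + 1) * ((1 + x) / 2)| ≤ 1 := by
      obtain ⟨h₁, h₂⟩ := abs_le.mp hx
      rw [abs_le]
      rcases hε' with h | h <;> rw [h] <;> constructor <;> linarith
    rw [nest, hstep, ih hbound, Finset.sum_Icc_succ_top (by omega),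
      Finset.prod_Icc_succ_top (by omega)]
    congr 2
    ring

/-- Lemma 1.1 (i): closed forms for `r_n(0)` and `r_n(2)`. -/
theorem nest_zero_and_two_eq (ε : ℕ → ℝ) (hε : ∀ i, 1 ≤ i → ε i = 1 ∨ ε i = -1)
    (n : ℕ) (hn : 1 ≤ n) :
    nest ε n 0 = 2 * Real.sin
      ((1 + ∑ i ∈ Finset.Icc 1 n, (∏ j ∈ Finset.Icc 1 i, ε j) / 2 ^ i) * (π / 4)) ∧
    nest ε n 2 = 2 * Real.sin
      ((1 + ∑ i ∈ Finset.Icc 1 n, (∏ j ∈ Finset.Icc 1 i, ε j) / 2 ^ i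
        + (∏ j ∈ Finset.Icc 1 n, ε j) / 2 ^ n) * (π / 4)) := by
  constructor
  · simpa using nest_two_mul_sin ε hε n (x := 0) (by simp)
  · simpa using nest_two_mul_sin ε hε n (x := 1) (by simp)
end

section
/- Every real number r ∈ [0, 2] admits a continued-radical representation: there exists a sequence ε : ℕ → ℝ with ε i ∈ {-1, 1} for all i ≥ 1 such that r = lim_{n→∞} r_n. Moreover this representation is unique among sign sequences that do NOT have the form: for some k ≥ 1, ε_k = ε_{k+1} = −1 and ε_i = 1 for all i ≥ k+2. -/
open Filter Real

/-- `ε` is a sign sequence: `ε i ∈ {-1, 1}` for all `i ≥ 1`. -/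
def IsSign (ε : ℕ → ℝ) : Prop := ∀ i, 1 ≤ i → ε i = 1 ∨ ε i = -1

/-- The exceptional tails: for some `k ≥ 1`, `ε_k = ε_{k+1} = -1` and `ε_i = 1`
for all `i ≥ k + 2`. -/
def InA (ε : ℕ → ℝ) : Prop :=
  ∃ k, 1 ≤ k ∧ ε k = -1 ∧ ε (k + 1) = -1 ∧ ∀ i, k + 2 ≤ i → ε i = 1

/-- The shift of a sequence. -/
def tailSeq (ε : ℕ → ℝ) : ℕ → ℝ := fun i => ε (i + 1)

lemma nest_succ_eq_sqrt (ε : ℕ → ℝ) (n : ℕ) (c : ℝ) :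
    nest ε (n + 1) c = √(2 + ε 1 * nest (tailSeq ε) n c) := by
  induction n generalizing c with
  | zero => simp [nest]
  | succ n ih => rw [nest, ih, nest, tailSeq]

lemma IsSign.tailSeq {ε : ℕ → ℝ} (h : IsSign ε) : IsSign (tailSeq ε) :=
  fun i hi => h (i + 1) (by omega)

lemma not_inA_tailSeq {ε : ℕ → ℝ} (h : ¬ InA ε) : ¬ InA (tailSeq ε) := by
  rintro ⟨k, _, h1, h2, h3⟩
  refine h ⟨k + 1, by omega, h1, h2, fun i hi => ?_⟩
  obtain ⟨j, rfl⟩ : ∃ j, i = j + 1 := ⟨i - 1, by omega⟩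
  exact h3 j (by omega)

lemma nest_mem_Icc {ε : ℕ → ℝ} (h : IsSign ε) (n : ℕ) : nest ε n 0 ∈ Set.Icc (0 : ℝ) 2 := by
  induction n generalizing ε with
  | zero =>
    refine ⟨Real.sqrt_nonneg _, Real.sqrt_le_iff.2 ?_⟩
    norm_num
  | succ n ih =>
    rw [nest_succ_eq_sqrt]
    obtain ⟨h0, h2⟩ := ih h.tailSeq
    refine ⟨Real.sqrt_nonneg _, Real.sqrt_le_iff.2 ⟨by norm_num, ?_⟩⟩
    rcases h 1 le_rfl with e | e <;> rw [e] <;> linarith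

/-- `ε` is a sign sequence whose nested radicals converge to `r`. -/
def Represents (ε : ℕ → ℝ) (r : ℝ) : Prop :=
  IsSign ε ∧ Tendsto (fun n => nest ε n 0) atTop (nhds r)

lemma Represents.mem_Icc {ε : ℕ → ℝ} {r : ℝ} (h : Represents ε r) : r ∈ Set.Icc (0 : ℝ) 2 :=
  isClosed_Icc.mem_of_tendsto h.2 (Eventually.of_forall (nest_mem_Icc h.1))

lemma Represents.tailSeq {ε : ℕ → ℝ} {r : ℝ} (h : Represents ε r) :
    Represents (tailSeq ε) (ε 1 * (r ^ 2 - 2)) := by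
  refine ⟨h.1.tailSeq, ?_⟩
  have ht : Tendsto (fun n => ε 1 * (nest ε (n + 1) 0 ^ 2 - 2)) atTop
      (nhds (ε 1 * (r ^ 2 - 2))) :=
    (((h.2.comp (tendsto_add_atTop_nat 1)).pow 2).sub_const 2).const_mul _
  refine ht.congr fun n => ?_
  obtain ⟨h0, h2⟩ := nest_mem_Icc h.1.tailSeq n
  rw [nest_succ_eq_sqrt]
  rcases h.1 1 le_rfl with e | e <;> rw [e, Real.sq_sqrt (by linarith)] <;> ring

lemma Represents.eq_one_of_two {ε : ℕ → ℝ} (h : Represents ε 2) {i : ℕ} (hi : 1 ≤ i) :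
    ε i = 1 := by
  have h1 : ε 1 = 1 := by
    rcases h.1 1 le_rfl with e | e
    · exact e
    · have := h.tailSeq.mem_Icc.1
      rw [e] at this
      norm_num at this
  induction i, hi using Nat.le_induction generalizing ε with
  | base => exact h1
  | succ i hi ih =>
    have ht : Represents (_root_.tailSeq ε) 2 := by
      have := h.tailSeq
      rw [h1] at this
      norm_num at this
      exact this
    refine ih ht ?_
    rcases ht.1 1 le_rfl with e | e
    · exact e
    · have := ht.tailSeq.mem_Icc.1
      rw [e] at this
      norm_num at this

lemma Represents.of_zero {ε : ℕ → ℝ} (h : Represents ε 0) :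
    ε 1 = -1 ∧ ∀ i, 2 ≤ i → ε i = 1 := by
  have ht := h.tailSeq
  rcases h.1 1 le_rfl with e | e
  · have := ht.mem_Icc.1
    rw [e] at this
    norm_num at this
  · refine ⟨e, fun i hi => ?_⟩
    rw [e] at ht
    norm_num at ht
    obtain ⟨j, rfl⟩ : ∃ j, i = j + 1 := ⟨i - 1, by omega⟩
    exact ht.eq_one_of_two (by omega)

lemma Represents.head_ne_neg_one {ε ε' : ℕ → ℝ} {r : ℝ} (h : Represents ε r)
    (h' : Represents ε' r) (hA' : ¬ InA ε') (e : ε 1 = 1) : ε' 1 ≠ -1 := by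
  intro e'
  have h0 := h.tailSeq.mem_Icc.1
  have ht' := h'.tailSeq
  have h0' := ht'.mem_Icc.1
  rw [e] at h0
  rw [e'] at h0' ht'
  rw [show -1 * (r ^ 2 - 2) = 0 by linarith] at ht'
  obtain ⟨h2, h3⟩ := ht'.of_zero
  refine hA' ⟨1, le_rfl, e', h2, fun i hi => ?_⟩
  obtain ⟨j, rfl⟩ : ∃ j, i = j + 1 := ⟨i - 1, by omega⟩
  exact h3 j (by omega)

lemma Represents.head_eq {ε ε' : ℕ → ℝ} {r : ℝ} (h : Represents ε r)
    (h' : Represents ε' r) (hA : ¬ InA ε) (hA' : ¬ InA ε') : ε 1 = ε' 1 := by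
  rcases h.1 1 le_rfl with e | e <;> rcases h'.1 1 le_rfl with e' | e'
  · rw [e, e']
  · exact absurd e' (h.head_ne_neg_one h' hA' e)
  · exact absurd e (h'.head_ne_neg_one h hA e')
  · rw [e, e']

lemma Represents.unique {ε ε' : ℕ → ℝ} {r : ℝ} (h : Represents ε r)
    (h' : Represents ε' r) (hA : ¬ InA ε) (hA' : ¬ InA ε') {i : ℕ} (hi : 1 ≤ i) :
    ε i = ε' i := by
  induction i, hi using Nat.le_induction generalizing ε ε' r with
  | base => exact h.head_eq h' hA hA'
  | succ i hi ih =>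
    have ht' := h'.tailSeq
    rw [← h.head_eq h' hA hA'] at ht'
    exact ih h.tailSeq ht' (not_inA_tailSeq hA) (not_inA_tailSeq hA')

lemma sqrt_two_add_two_mul_cos {φ : ℝ} (hφ : φ ∈ Set.Icc 0 π) :
    √(2 + 2 * cos φ) = 2 * cos (φ / 2) := by
  have hc : 0 ≤ cos (φ / 2) :=
    cos_nonneg_of_mem_Icc ⟨by linarith [hφ.1, pi_pos], by linarith [hφ.2]⟩
  have h2 : cos φ = 2 * cos (φ / 2) ^ 2 - 1 := by
    rw [← cos_two_mul]
    congr 1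
    ring
  rw [h2, show 2 + 2 * (2 * cos (φ / 2) ^ 2 - 1) = (2 * cos (φ / 2)) ^ 2 by ring,
    Real.sqrt_sq (by positivity)]

/-- In the angular coordinate `c = 2 cos φ`, nested radicals contract by a factor `2` per level. -/
lemma exists_angles_nest {ε : ℕ → ℝ} (h : IsSign ε) (n : ℕ) {φ ψ : ℝ}
    (hφ : φ ∈ Set.Icc 0 π) (hψ : ψ ∈ Set.Icc 0 π) :
    ∃ α β : ℝ, nest ε n (2 * cos φ) = 2 * cos α ∧ nest ε n (2 * cos ψ) = 2 * cos β ∧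
      |α - β| ≤ |φ - ψ| * (1 / 2) ^ (n + 1) := by
  have hd (x y : ℝ) : |x / 2 - y / 2| = |x - y| / 2 := by
    rw [← sub_div, abs_div, abs_two]
  induction n generalizing φ ψ with
  | zero =>
    refine ⟨φ / 2, ψ / 2, sqrt_two_add_two_mul_cos hφ, sqrt_two_add_two_mul_cos hψ, ?_⟩
    rw [hd]
    exact le_of_eq (by ring)
  | succ n ih =>
    simp only [nest, sqrt_two_add_two_mul_cos hφ, sqrt_two_add_two_mul_cos hψ]
    obtain ⟨hφ0, hφπ⟩ := hφ
    obtain ⟨hψ0, hψπ⟩ := hψ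
    rcases h (n + 1) (by omega) with e | e
    · obtain ⟨α, β, hα, hβ, hαβ⟩ := ih (φ := φ / 2) (ψ := ψ / 2)
        ⟨by linarith, by linarith⟩ ⟨by linarith, by linarith⟩
      refine ⟨α, β, by rw [e, one_mul, hα], by rw [e, one_mul, hβ], hαβ.trans_eq ?_⟩
      rw [hd]
      ring
    · obtain ⟨α, β, hα, hβ, hαβ⟩ := ih (φ := π - φ / 2) (ψ := π - ψ / 2)
        ⟨by linarith, by linarith⟩ ⟨by linarith, by linarith⟩
      rw [cos_pi_sub, mul_neg] at hα hβ
      refine ⟨α, β, by rw [e, neg_one_mul, hα], by rw [e, neg_one_mul, hβ], hαβ.trans_eq ?_⟩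
      rw [sub_sub_sub_cancel_left, abs_sub_comm, hd]
      ring

lemma abs_nest_sub_nest_le {ε : ℕ → ℝ} (h : IsSign ε) (n : ℕ) {c d : ℝ}
    (hc : c ∈ Set.Icc (-2 : ℝ) 2) (hd : d ∈ Set.Icc (-2 : ℝ) 2) :
    |nest ε n c - nest ε n d| ≤ π * (1 / 2) ^ n := by
  have key : ∀ {x : ℝ}, x ∈ Set.Icc (-2 : ℝ) 2 → 2 * cos (arccos (x / 2)) = x := by
    intro x hx
    rw [cos_arccos (by linarith [hx.1]) (by linarith [hx.2])]
    ring
  have hmem : ∀ x : ℝ, arccos x ∈ Set.Icc 0 π := fun x => ⟨arccos_nonneg x, arccos_le_pi x⟩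
  obtain ⟨α, β, hα, hβ, hαβ⟩ := exists_angles_nest h n (hmem (c / 2)) (hmem (d / 2))
  rw [key hc] at hα
  rw [key hd] at hβ
  have hπ : |arccos (c / 2) - arccos (d / 2)| ≤ π :=
    abs_sub_le_iff.2 ⟨by linarith [(hmem (c / 2)).2, (hmem (d / 2)).1],
      by linarith [(hmem (d / 2)).2, (hmem (c / 2)).1]⟩
  calc |nest ε n c - nest ε n d| = 2 * |cos α - cos β| := by
        rw [hα, hβ, ← mul_sub, abs_mul, abs_two]
    _ ≤ 2 * |α - β| := mul_le_mul_of_nonneg_left (abs_cos_sub_cos_le α β) zero_le_two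
    _ ≤ 2 * (π * (1 / 2) ^ (n + 1)) := by
        gcongr
        exact hαβ.trans (by gcongr)
    _ = π * (1 / 2) ^ n := by ring

/-- The orbit of `r` under `x ↦ |x² - 2|`: the successive tails of a representation of `r`. -/
noncomputable def radOrbit (r : ℝ) : ℕ → ℝ
  | 0 => r
  | n + 1 => |radOrbit r n ^ 2 - 2|

open Classical in
/-- The signs of `x² - 2` along the orbit of `r`. -/
noncomputable def radSign (r : ℝ) (i : ℕ) : ℝ :=
  if 0 ≤ radOrbit r (i - 1) ^ 2 - 2 then 1 else -1

lemma isSign_radSign (r : ℝ) : IsSign (radSign r) := by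
  intro i _
  unfold radSign
  split_ifs <;> simp

lemma radSign_succ_mul_radOrbit_succ (r : ℝ) (n : ℕ) :
    radSign r (n + 1) * radOrbit r (n + 1) = radOrbit r n ^ 2 - 2 := by
  simp only [radSign, radOrbit, Nat.add_sub_cancel]
  split_ifs with h
  · rw [abs_of_nonneg h, one_mul]
  · rw [abs_of_neg (not_le.1 h), neg_mul_neg, one_mul]

lemma radOrbit_mem_Icc {r : ℝ} (hr : r ∈ Set.Icc (0 : ℝ) 2) (n : ℕ) :
    radOrbit r n ∈ Set.Icc (0 : ℝ) 2 := by
  induction n with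
  | zero => exact hr
  | succ n ih =>
    obtain ⟨h0, h2⟩ := ih
    exact ⟨abs_nonneg _, abs_le.2 ⟨by nlinarith, by nlinarith⟩⟩

lemma nest_radSign {r : ℝ} (hr : r ∈ Set.Icc (0 : ℝ) 2) (n : ℕ) :
    nest (radSign r) n (radOrbit r n ^ 2 - 2) = r := by
  induction n with
  | zero => simp [nest, radOrbit, Real.sqrt_sq hr.1]
  | succ n ih =>
    rw [nest, add_sub_cancel, Real.sqrt_sq (radOrbit_mem_Icc hr _).1,
      radSign_succ_mul_radOrbit_succ, ih]

lemma represents_radSign {r : ℝ} (hr : r ∈ Set.Icc (0 : ℝ) 2) : Represents (radSign r) r := by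
  refine ⟨isSign_radSign r, tendsto_iff_norm_sub_tendsto_zero.2 ?_⟩
  have hlim : Tendsto (fun n : ℕ => π * (1 / 2 : ℝ) ^ n) atTop (nhds 0) := by
    simpa using (tendsto_pow_atTop_nhds_zero_of_lt_one (r := (1 / 2 : ℝ))
      (by norm_num) (by norm_num)).const_mul π
  refine squeeze_zero (fun _ => norm_nonneg _) (fun n => ?_) hlim
  obtain ⟨h0, h2⟩ := radOrbit_mem_Icc hr n
  have := abs_nest_sub_nest_le (isSign_radSign r) n (c := 0) (d := radOrbit r n ^ 2 - 2)
    ⟨by norm_num, by norm_num⟩ ⟨by nlinarith, by nlinarith⟩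
  rwa [nest_radSign hr] at this

/-- Corollary 2.2: every `r ∈ [0, 2]` has a continued-radical representation
`r = √(2 + ε₁√(2 + ε₂√(2 + ⋯)))`, and this representation is unique among sign
sequences not of the exceptional form. -/
theorem continued_radical_repr_exists_unique (r : ℝ) (hr : r ∈ Set.Icc (0 : ℝ) 2) :
    (∃ ε : ℕ → ℝ, IsSign ε ∧
      Filter.Tendsto (fun n => nest ε n 0) Filter.atTop (nhds r)) ∧
    (∀ ε ε' : ℕ → ℝ, IsSign ε → IsSign ε' → ¬ InA ε → ¬ InA ε' →
      Filter.Tendsto (fun n => nest ε n 0) Filter.atTop (nhds r) →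
      Filter.Tendsto (fun n => nest ε' n 0) Filter.atTop (nhds r) →
        ∀ i, 1 ≤ i → ε i = ε' i) := by
  exact ⟨⟨radSign r, represents_radSign hr⟩, fun ε ε' hs hs' hA hA' ht ht' i hi =>
    Represents.unique ⟨hs, ht⟩ ⟨hs', ht'⟩ hA hA' hi⟩
end

section
/- Let s ≥ 3 be an odd integer and t an integer with gcd(t, s) = 1 and 0 < t/s < 1/2. Define ε_i = cos(2^i·tπ/s)/|cos(2^i·tπ/s)| for i ≥ 1 (these cosines are nonzero since s is odd). Then the sequence (ε_i) is totally periodic (indeed ε_{i+φ(s)} = ε_i for all i ≥ 1, where φ is Euler's totient function), and lim_{n→∞} r_n = 2·cos(tπ/s). -/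
open Filter Real

lemma sqrt_two_add_two_mul_cos_s9 (θ : ℝ) : √(2 + 2 * cos (2 * θ)) = 2 * |cos θ| := by
  rw [cos_two_mul, show 2 + 2 * (2 * cos θ ^ 2 - 1) = (2 * cos θ) ^ 2 by ring, sqrt_sq_eq_abs,
    abs_mul, abs_two]

lemma sqrt_two_add_two_mul_cos_of_mem {θ : ℝ} (hθ : θ ∈ Set.Icc 0 π) :
    √(2 + 2 * cos θ) = 2 * cos (θ / 2) := by
  have h := sqrt_two_add_two_mul_cos_s9 (θ / 2)
  rwa [mul_div_cancel₀ θ two_ne_zero, abs_of_nonneg (cos_nonneg_of_neg_pi_div_two_le_of_le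
    (by linarith [hθ.1, pi_pos]) (by linarith [hθ.2]))] at h

/-- In the angular variable, each radical of `nest` halves distances. -/
lemma abs_nest_sub_nest_le_s9 {ε : ℕ → ℝ}
    (hε : ∀ i, 1 ≤ i → ε i = 1 ∨ ε i = -1 ∨ ε i = 0) (n : ℕ) :
    ∀ {θ θ' : ℝ}, θ ∈ Set.Icc 0 π → θ' ∈ Set.Icc 0 π →
      |nest ε n (2 * cos θ) - nest ε n (2 * cos θ')| ≤ |θ - θ'| / 2 ^ n := by
  induction n with
  | zero =>
    intro θ θ' h h'
    have hc := abs_cos_sub_cos_le (θ / 2) (θ' / 2)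
    rw [← sub_div, abs_div, abs_two] at hc
    rw [nest, nest, sqrt_two_add_two_mul_cos_of_mem h, sqrt_two_add_two_mul_cos_of_mem h',
      ← mul_sub, abs_mul, abs_two]
    linarith
  | succ n ih =>
    intro θ θ' h h'
    have half : ∀ {x : ℝ}, x ∈ Set.Icc 0 π → x / 2 ∈ Set.Icc 0 π := fun hx =>
      ⟨by linarith [hx.1], by linarith [hx.1, hx.2]⟩
    have compl : ∀ {x : ℝ}, x ∈ Set.Icc 0 π → π - x / 2 ∈ Set.Icc 0 π := fun hx =>
      ⟨by linarith [hx.1, hx.2], by linarith [hx.1]⟩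
    have hdist : |θ - θ'| / 2 ^ (n + 1) = |θ / 2 - θ' / 2| / 2 ^ n := by
      rw [← sub_div, abs_div, abs_two, pow_succ', div_div]
    rw [nest, nest, sqrt_two_add_two_mul_cos_of_mem h, sqrt_two_add_two_mul_cos_of_mem h', hdist]
    rcases hε (n + 1) (by omega) with he | he | he
    · simpa [he] using ih (half h) (half h')
    · have := ih (compl h) (compl h')
      rw [cos_pi_sub, cos_pi_sub, sub_sub_sub_cancel_left, abs_sub_comm (θ' / 2)] at this
      simpa [he] using this
    · simp only [he, zero_mul, sub_self, abs_zero]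
      positivity

lemma div_abs_self_eq (x : ℝ) : x / |x| = 1 ∨ x / |x| = -1 ∨ x / |x| = 0 := by
  rcases lt_trichotomy x 0 with h | rfl | h
  · right; left
    rw [abs_of_neg h, div_neg, div_self h.ne]
  · simp
  · left
    rw [abs_of_pos h, div_self h.ne']

lemma div_abs_self_mul_abs (x : ℝ) : x / |x| * |x| = x := by
  rcases eq_or_ne x 0 with rfl | h
  · simp
  · exact div_mul_cancel₀ x (abs_ne_zero.mpr h)

lemma nest_two_mul_cos {ε : ℕ → ℝ} {α : ℝ} (hα : 0 ≤ cos α)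
    (hε : ∀ i, 1 ≤ i → ε i = cos (2 ^ i * α) / |cos (2 ^ i * α)|) (n : ℕ) :
    nest ε n (2 * cos (2 ^ (n + 1) * α)) = 2 * cos α := by
  induction n with
  | zero => rw [nest, zero_add, pow_one, sqrt_two_add_two_mul_cos_s9, abs_of_nonneg hα]
  | succ n ih =>
    rw [nest, pow_succ' 2 (n + 1), mul_assoc, sqrt_two_add_two_mul_cos_s9, hε (n + 1) (by omega),
      mul_left_comm, div_abs_self_mul_abs, ih]

lemma tendsto_nest_two_mul_cos {ε : ℕ → ℝ} {α : ℝ} (hα : 0 ≤ cos α)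
    (hε : ∀ i, 1 ≤ i → ε i = cos (2 ^ i * α) / |cos (2 ^ i * α)|) :
    Tendsto (fun n => nest ε n 0) atTop (nhds (2 * cos α)) := by
  have hsign : ∀ i, 1 ≤ i → ε i = 1 ∨ ε i = -1 ∨ ε i = 0 := fun i hi => by
    rw [hε i hi]
    exact div_abs_self_eq _
  have hlim : Tendsto (fun n : ℕ => π * (1 / 2 : ℝ) ^ n) atTop (nhds 0) := by
    simpa using (tendsto_pow_atTop_nhds_zero_of_lt_one (r := (1 / 2 : ℝ)) (by norm_num)
      (by norm_num)).const_mul π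
  rw [tendsto_iff_dist_tendsto_zero]
  refine squeeze_zero (fun _ => dist_nonneg) (fun n => ?_) hlim
  set β := arccos (cos (2 ^ (n + 1) * α)) with hβ
  have hβmem : β ∈ Set.Icc 0 π := ⟨arccos_nonneg _, arccos_le_pi _⟩
  have hmem : π / 2 ∈ Set.Icc 0 π := ⟨by positivity, by linarith [pi_pos]⟩
  have h := abs_nest_sub_nest_le_s9 hsign n hmem hβmem
  rw [hβ, cos_arccos (neg_one_le_cos _) (cos_le_one _), nest_two_mul_cos hα hε, cos_pi_div_two,
    mul_zero, ← hβ] at h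
  rw [Real.dist_eq, one_div, inv_pow, ← div_eq_mul_inv]
  refine h.trans ?_
  gcongr
  rw [abs_le]
  constructor <;> linarith [hβmem.1, hβmem.2, pi_pos]

lemma cos_two_pow_add_totient {s : ℕ} (hodd : Odd s) (t : ℤ) {i : ℕ} (hi : 1 ≤ i) :
    cos (2 ^ (i + s.totient) * t * π / s) = cos (2 ^ i * t * π / s) := by
  have hs : (s : ℝ) ≠ 0 := by exact_mod_cast hodd.pos.ne'
  obtain ⟨k, hk⟩ : (s : ℤ) ∣ 2 ^ s.totient - 1 := by
    have h := (Nat.ModEq.pow_totient (Nat.coprime_two_left.mpr hodd)).symm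
    simpa using (Nat.modEq_iff_dvd.mp h)
  have hk' : (2 : ℝ) ^ s.totient = 1 + s * k := by
    have h : ((2 : ℝ) ^ s.totient - 1) = s * k := by exact_mod_cast hk
    linarith
  obtain ⟨j, rfl⟩ := Nat.exists_eq_add_of_le' hi
  rw [← cos_add_int_mul_two_pi (2 ^ (j + 1) * t * π / s) (2 ^ j * t * k)]
  congr 1
  push_cast
  rw [pow_add, hk', pow_succ]
  field_simp

/-- Theorem 4 (converse direction): for odd `s ≥ 3` and `t` coprime to `s` with
`0 < t/s < 1/2`, the sign sequence `ε_i = cos(2^i tπ/s)/|cos(2^i tπ/s)|` is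
totally periodic with period `φ(s)`, and the associated continued radical of 2
converges to `2 cos(tπ/s)`. -/
theorem two_cos_rat_totally_periodic (s : ℕ) (hs : 3 ≤ s) (hodd : Odd s)
    (t : ℤ) (hco : Int.gcd t s = 1)
    (ht0 : 0 < (t : ℝ) / s) (ht1 : (t : ℝ) / s < 1 / 2)
    (ε : ℕ → ℝ)
    (hε : ∀ i, 1 ≤ i →
      ε i = Real.cos (2 ^ i * t * π / s) / |Real.cos (2 ^ i * t * π / s)|) :
    (∀ i, 1 ≤ i → ε (i + Nat.totient s) = ε i) ∧
    Filter.Tendsto (fun n => nest ε n 0) Filter.atTop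
      (nhds (2 * Real.cos (t * π / s))) := by
  refine ⟨fun i hi => ?_, ?_⟩
  · rw [hε i hi, hε _ (by omega), cos_two_pow_add_totient hodd t hi]
  · have hα : t * π / s = t / s * π := by ring
    refine tendsto_nest_two_mul_cos (cos_nonneg_of_neg_pi_div_two_le_of_le ?_ ?_) fun i hi => ?_
    · rw [hα]
      nlinarith [pi_pos]
    · rw [hα]
      nlinarith [pi_pos]
    · rw [hε i hi, mul_assoc, mul_div_assoc]
end
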